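/- Assume σ > 1, τ > 1, σ ≠ τ, α² = π²/2 and η > 0. Then: (i) if λ < λ_c, every complex root of f_{jl} has negative real part, for every j ∈ ℤ and every l ≥ 1; (ii) if λ = λ_c, then 0 is a simple root of f_{11}, every other root of f_{11} has negative real part, and every root of f_{jl} for (j², l) ≠ (1, 1) has negative real part; (iii) if λ > λ_c, then f_{11} has a positive real root. -/

import Mathlib

open Real

/-- γ_{jl}² = j²α² + l²π². -/
noncomputable def gamma2 (α : ℝ) (j : ℤ) (l : ℕ) : ℝ :=
  (j : ℝ)^2 * α^2 + (l : ℝ)^2 * π^2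

/-- The cubic polynomial f_{jl}(β), real coefficients. -/
noncomputable def fjl (σ τ lam η α : ℝ) (j : ℤ) (l : ℕ) (β : ℝ) : ℝ :=
  β^3 + (σ + τ + 1) * gamma2 α j l * β^2
    + ((σ + τ + σ*τ) * (gamma2 α j l)^2
        - σ * (j : ℝ)^2 * α^2 * (gamma2 α j l)⁻¹ * (lam - η)) * β
    + σ * τ * (gamma2 α j l)^3 + σ * (j : ℝ)^2 * α^2 * (η - τ * lam)

/-- The cubic polynomial f_{jl}(β) evaluated at complex arguments via its real
coefficients. -/
noncomputable def fjlC (σ τ lam η α : ℝ) (j : ℤ) (l : ℕ) (β : ℂ) : ℂ :=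
  β^3 + (((σ + τ + 1) * gamma2 α j l : ℝ) : ℂ) * β^2
    + ((((σ + τ + σ*τ) * (gamma2 α j l)^2
        - σ * (j : ℝ)^2 * α^2 * (gamma2 α j l)⁻¹ * (lam - η)) : ℝ) : ℂ) * β
    + (((σ * τ * (gamma2 α j l)^3 + σ * (j : ℝ)^2 * α^2 * (η - τ * lam)) : ℝ) : ℂ)

/-- Routh–Hurwitz criterion for a real cubic, allowing a zero constant term. -/
theorem re_neg_of_cubic_eq_zero {A B C : ℝ} (hA : 0 < A) (hC : 0 ≤ C) (hABC : C < A * B)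
    {β : ℂ} (hβ : β ≠ 0) (h : β ^ 3 + (A : ℂ) * β ^ 2 + (B : ℂ) * β + (C : ℂ) = 0) :
    β.re < 0 := by
  have hB : 0 < B := pos_of_mul_pos_right (hC.trans_lt hABC) hA.le
  obtain ⟨x, y⟩ := β
  have hre := congrArg Complex.re h
  have him := congrArg Complex.im h
  simp only [pow_succ, pow_zero, one_mul, Complex.add_re, Complex.mul_re, Complex.ofReal_re,
    Complex.ofReal_im, Complex.add_im, Complex.mul_im, Complex.zero_re, Complex.zero_im] at hre him
  change x < 0
  by_contra! hx
  by_cases hy : y = 0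
  · subst hy
    have hx' : 0 < x := hx.lt_of_ne fun h0 => hβ (by subst h0; rfl)
    have : 0 < x ^ 3 + A * x ^ 2 + B * x := by positivity
    linarith
  · have hy2 : y ^ 2 = 3 * x ^ 2 + 2 * A * x + B :=
      mul_left_cancel₀ hy (by linear_combination -him)
    have h8 : 8 * x ^ 3 + 8 * A * x ^ 2 + (2 * B + 2 * A ^ 2) * x + (A * B - C) = 0 := by
      linear_combination -hre - (3 * x + A) * hy2
    have : 0 ≤ 8 * x ^ 3 + 8 * A * x ^ 2 + (2 * B + 2 * A ^ 2) * x := by positivity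
    linarith

theorem exists_pos_root_of_cubic {A B C : ℝ} (hA : 0 ≤ A) (hC : C < 0) :
    ∃ x : ℝ, 0 < x ∧ x ^ 3 + A * x ^ 2 + B * x + C = 0 := by
  set M := 1 + |B| + |C| with hM
  have hM1 : 1 ≤ M := by linarith [abs_nonneg B, abs_nonneg C]
  have hM0 : 0 ≤ M := zero_le_one.trans hM1
  have hfM : 0 ≤ M ^ 3 + A * M ^ 2 + B * M + C := by
    have h1 : 0 ≤ A * M ^ 2 := by positivity
    have h2 : M ^ 2 ≤ M ^ 3 := pow_le_pow_right₀ hM1 (by norm_num)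
    have h3 : -|B| * M ≤ B * M := by gcongr; exact neg_abs_le B
    have h4 : |C| * 1 ≤ |C| * M := by gcongr
    have h5 : M ^ 2 = M + |B| * M + |C| * M := by rw [hM]; ring
    linarith [neg_abs_le C]
  obtain ⟨x, ⟨hx0, -⟩, hx⟩ := intermediate_value_Icc hM0
    (f := fun x : ℝ => x ^ 3 + A * x ^ 2 + B * x + C) (by fun_prop)
    (show (0 : ℝ) ∈ Set.Icc _ _ from ⟨by simpa using hC.le, hfM⟩)
  refine ⟨x, hx0.lt_of_ne ?_, hx⟩
  rintro rfl
  simp at hx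
  exact hC.ne hx

theorem deriv_cubic_zero (A B C : ℂ) :
    deriv (fun β : ℂ => β ^ 3 + A * β ^ 2 + B * β + C) 0 = B := by
  have h := ((((hasDerivAt_pow 3 (0 : ℂ))).add ((hasDerivAt_pow 2 (0 : ℂ)).const_mul A)).add
    ((hasDerivAt_id (0 : ℂ)).const_mul B)).add_const C
  simpa using h.deriv

theorem mul_le_cube {a p g : ℝ} (ha : 0 ≤ a) (hp : 0 < p) (hg : a + p ≤ g) :
    27 / 4 * p ^ 2 * a ≤ g ^ 3 := by
  have h1 : (a + p) ^ 3 ≤ g ^ 3 := by gcongr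
  have h2 : 0 ≤ (a - p / 2) ^ 2 * (a + 4 * p) := by positivity
  linarith

theorem mul_lt_cube {a p g : ℝ} (ha : 0 ≤ a) (hp : 0 < p) (hg : a + p ≤ g)
    (hne : a + p < g ∨ a ≠ p / 2) : 27 / 4 * p ^ 2 * a < g ^ 3 := by
  rcases hne with hlt | hne
  · have h1 : (a + p) ^ 3 < g ^ 3 := by gcongr
    linarith [mul_le_cube ha hp le_rfl]
  · have h1 : (a + p) ^ 3 ≤ g ^ 3 := by gcongr
    have h2 : 0 < (a - p / 2) ^ 2 * (a + 4 * p) :=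
      mul_pos (sq_pos_of_ne_zero (sub_ne_zero.mpr hne)) (by positivity)
    linarith

theorem add_sq_pi_le_gamma2 (α : ℝ) (j : ℤ) {l : ℕ} (hl : 1 ≤ l) :
    (j : ℝ) ^ 2 * α ^ 2 + π ^ 2 ≤ gamma2 α j l := by
  have hl' : (1 : ℝ) ≤ (l : ℝ) ^ 2 := one_le_pow₀ (by exact_mod_cast hl)
  have := mul_le_mul_of_nonneg_right hl' (sq_nonneg π)
  unfold gamma2
  linarith

theorem gamma2_one_one {α : ℝ} (hα : α ^ 2 = π ^ 2 / 2) : gamma2 α 1 1 = 3 / 2 * π ^ 2 := by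
  simp only [gamma2, hα, Int.cast_one, Nat.cast_one]
  ring

theorem mul_lt_gamma2_cube {α : ℝ} (hα : α ^ 2 = π ^ 2 / 2) {j : ℤ} {l : ℕ} (hl : 1 ≤ l)
    (hjl : (j ^ 2, l) ≠ ((1 : ℤ), (1 : ℕ))) :
    27 / 4 * (π ^ 2) ^ 2 * ((j : ℝ) ^ 2 * α ^ 2) < gamma2 α j l ^ 3 := by
  have hp : 0 < π ^ 2 := by positivity
  refine mul_lt_cube (by positivity) hp (add_sq_pi_le_gamma2 α j hl) ?_
  by_cases hl1 : l = 1
  · right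
    intro h
    rw [hα] at h
    have hj : (j : ℝ) ^ 2 = 1 := mul_right_cancel₀ (half_pos hp).ne' (by linarith)
    exact hjl (by rw [hl1, show j ^ 2 = 1 by exact_mod_cast hj])
  · left
    have hl2 : (1 : ℝ) < (l : ℝ) ^ 2 :=
      one_lt_pow₀ (by exact_mod_cast hl.lt_of_ne' hl1) two_ne_zero
    have := mul_lt_mul_of_pos_right hl2 hp
    unfold gamma2
    linarith

/-- Up to the critical value of `lam`, the Hurwitz determinant of `f_{jl}` is positive. -/
theorem const_lt_mul_coeff {σ τ η lam a g : ℝ} (hσ : 1 < σ) (hτ : 1 < τ) (hη : 0 < η)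
    (hlam : lam ≤ η / τ + 27 / 4 * π ^ 4) (ha : 0 ≤ a) (hg : 0 < g)
    (hag : 27 / 4 * (π ^ 2) ^ 2 * a ≤ g ^ 3) :
    σ * τ * g ^ 3 + σ * a * (η - τ * lam) <
      (σ + τ + 1) * g * ((σ + τ + σ * τ) * g ^ 2 - σ * a * g⁻¹ * (lam - η)) := by
  have hlam' : (σ + 1) * lam - (σ + τ) * η ≤ (σ + 1) * (27 / 4 * π ^ 4) := by
    have h1 : (σ + 1) * lam ≤ (σ + 1) * (η / τ + 27 / 4 * π ^ 4) := by gcongr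
    have h2 : η / τ ≤ η := div_le_self hη.le hτ.le
    have h3 : (σ + 1) * (η / τ) ≤ (σ + τ) * η := by gcongr
    linarith
  have h1 : σ * a * ((σ + 1) * lam - (σ + τ) * η) ≤ σ * a * ((σ + 1) * (27 / 4 * π ^ 4)) := by
    gcongr
  have h2 : σ * (σ + 1) * (27 / 4 * (π ^ 2) ^ 2 * a) ≤ σ * (σ + 1) * g ^ 3 := by gcongr
  have h3 : 0 < (σ + 1) * (σ * τ + τ + τ ^ 2) * g ^ 3 := by positivity
  have h4 : (σ + τ + 1) * g * ((σ + τ + σ * τ) * g ^ 2 - σ * a * g⁻¹ * (lam - η)) =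
      (σ + τ + 1) * (σ + τ + σ * τ) * g ^ 3 - (σ + τ + 1) * (σ * a * (lam - η)) := by
    field_simp
  rw [h4]
  linarith

theorem const_pos {σ τ η lam a g : ℝ} (hσ : 0 < σ) (hτ : 0 < τ) (ha : 0 ≤ a) (hg : 0 < g)
    (hlam : lam ≤ η / τ + 27 / 4 * π ^ 4) (hag : 27 / 4 * (π ^ 2) ^ 2 * a ≤ g ^ 3)
    (hlt : lam < η / τ + 27 / 4 * π ^ 4 ∨ 27 / 4 * (π ^ 2) ^ 2 * a < g ^ 3) :
    0 < σ * τ * g ^ 3 + σ * a * (η - τ * lam) := by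
  have hsplit : σ * τ * g ^ 3 + σ * a * (η - τ * lam) =
      σ * τ * ((g ^ 3 - 27 / 4 * (π ^ 2) ^ 2 * a) + a * (η / τ + 27 / 4 * π ^ 4 - lam)) := by
    field_simp
    ring
  rw [hsplit]
  refine mul_pos (by positivity) ?_
  have hnonneg := mul_nonneg ha (sub_nonneg.mpr hlam)
  rcases hlt with h | h
  · rcases ha.eq_or_lt with rfl | ha'
    · have : 0 < g ^ 3 := by positivity
      linarith
    · linarith [mul_pos ha' (sub_pos.mpr h)]
  · linarith

/-- The constant term of `f_{11}`. -/
theorem const_one_one {σ τ η α lam : ℝ} (hτ : τ ≠ 0) (hα : α ^ 2 = π ^ 2 / 2) :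
    σ * τ * gamma2 α 1 1 ^ 3 + σ * ((1 : ℤ) : ℝ) ^ 2 * α ^ 2 * (η - τ * lam) =
      σ * τ * (π ^ 2 / 2) * (η / τ + 27 / 4 * π ^ 4 - lam) := by
  rw [gamma2_one_one hα, hα, Int.cast_one]
  field_simp
  ring

theorem fjlC_const_lt_mul_coeff {σ τ η lam : ℝ} (α : ℝ) (hσ : 1 < σ) (hτ : 1 < τ) (hη : 0 < η)
    (hlam : lam ≤ η / τ + 27 / 4 * π ^ 4) (j : ℤ) {l : ℕ} (hl : 1 ≤ l) :
    σ * τ * gamma2 α j l ^ 3 + σ * (j : ℝ) ^ 2 * α ^ 2 * (η - τ * lam) <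
      (σ + τ + 1) * gamma2 α j l * ((σ + τ + σ * τ) * gamma2 α j l ^ 2
        - σ * (j : ℝ) ^ 2 * α ^ 2 * (gamma2 α j l)⁻¹ * (lam - η)) := by
  have ha : 0 ≤ (j : ℝ) ^ 2 * α ^ 2 := by positivity
  have hp : 0 < π ^ 2 := by positivity
  have hg := add_sq_pi_le_gamma2 α j hl
  rw [mul_assoc σ ((j : ℝ) ^ 2) (α ^ 2)]
  exact const_lt_mul_coeff hσ hτ hη hlam ha (by linarith) (mul_le_cube ha hp hg)

theorem gamma2_pos (α : ℝ) (j : ℤ) {l : ℕ} (hl : 1 ≤ l) : 0 < gamma2 α j l :=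
  lt_of_lt_of_le (by positivity) (add_sq_pi_le_gamma2 α j hl)

theorem re_neg_of_fjlC_eq_zero {σ τ η α lam : ℝ} (hσ : 1 < σ) (hτ : 1 < τ) (hη : 0 < η)
    (hlam : lam ≤ η / τ + 27 / 4 * π ^ 4) {j : ℤ} {l : ℕ} (hl : 1 ≤ l)
    (hlt : lam < η / τ + 27 / 4 * π ^ 4 ∨
      27 / 4 * (π ^ 2) ^ 2 * ((j : ℝ) ^ 2 * α ^ 2) < gamma2 α j l ^ 3)
    {β : ℂ} (hβ : fjlC σ τ lam η α j l β = 0) : β.re < 0 := by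
  have ha : 0 ≤ (j : ℝ) ^ 2 * α ^ 2 := by positivity
  have hg := gamma2_pos α j hl
  have hag := mul_le_cube ha (by positivity) (add_sq_pi_le_gamma2 α j hl)
  have hC := const_pos (by linarith) (by linarith) ha hg hlam hag hlt (σ := σ)
  rw [← mul_assoc σ] at hC
  refine re_neg_of_cubic_eq_zero (by positivity) hC.le
    (fjlC_const_lt_mul_coeff α hσ hτ hη hlam j hl) ?_ hβ
  rintro rfl
  refine hC.ne' (Complex.ofReal_eq_zero.mp ?_)
  rw [← hβ, fjlC]
  ring

/-- Principle of Exchange of Stabilities for σ > 1, τ > 1,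
σ ≠ τ, α² = π²/2, η > 0. -/
theorem stmt5 (σ τ η α lam : ℝ)
    (hσ : 1 < σ) (hτ : 1 < τ) (hστ : σ ≠ τ)
    (hη0 : 0 < η)
    (hα : α^2 = π^2 / 2) :
    (lam < η / τ + (27/4) * π^4 →
      ∀ j : ℤ, ∀ l : ℕ, 1 ≤ l →
        ∀ β : ℂ, fjlC σ τ lam η α j l β = 0 → β.re < 0) ∧
    (lam = η / τ + (27/4) * π^4 →
      fjlC σ τ lam η α 1 1 0 = 0 ∧
      deriv (fjlC σ τ lam η α 1 1) 0 ≠ 0 ∧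
      (∀ β : ℂ, fjlC σ τ lam η α 1 1 β = 0 → β ≠ 0 → β.re < 0) ∧
      (∀ j : ℤ, ∀ l : ℕ, 1 ≤ l → (j^2, l) ≠ ((1 : ℤ), (1 : ℕ)) →
        ∀ β : ℂ, fjlC σ τ lam η α j l β = 0 → β.re < 0)) ∧
    (lam > η / τ + (27/4) * π^4 →
      ∃ β : ℝ, 0 < β ∧ fjl σ τ lam η α 1 1 β = 0) := by
  have hτ0 : τ ≠ 0 := by positivity
  refine ⟨fun hlam j l hl β hβ => re_neg_of_fjlC_eq_zero hσ hτ hη0 hlam.le hl (Or.inl hlam) hβ,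
    fun hlam => ?_, fun hlam => ?_⟩
  · have hC := const_one_one (σ := σ) (η := η) (lam := lam) hτ0 hα
    rw [sub_eq_zero.mpr hlam.symm, mul_zero] at hC
    have hg := gamma2_pos α 1 le_rfl
    have hABC := fjlC_const_lt_mul_coeff α hσ hτ hη0 hlam.le 1 le_rfl
    refine ⟨?_, ?_, fun β hβ hβ0 =>
        re_neg_of_cubic_eq_zero (by positivity) hC.ge hABC hβ0 hβ,
      fun j l hl hjl β hβ =>
        re_neg_of_fjlC_eq_zero hσ hτ hη0 hlam.le hl (Or.inr (mul_lt_gamma2_cube hα hl hjl)) hβ⟩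
    · rw [fjlC, hC]
      simp
    · unfold fjlC
      rw [deriv_cubic_zero, Complex.ofReal_ne_zero]
      rw [hC] at hABC
      exact (pos_of_mul_pos_right hABC (by positivity)).ne'
  · have hC := const_one_one (σ := σ) (η := η) (lam := lam) hτ0 hα
    have hg := gamma2_pos α 1 le_rfl
    obtain ⟨β, hβ0, hβ⟩ := exists_pos_root_of_cubic
      (A := (σ + τ + 1) * gamma2 α 1 1)
      (B := (σ + τ + σ * τ) * gamma2 α 1 1 ^ 2
        - σ * ((1 : ℤ) : ℝ) ^ 2 * α ^ 2 * (gamma2 α 1 1)⁻¹ * (lam - η))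
      (C := σ * τ * gamma2 α 1 1 ^ 3 + σ * ((1 : ℤ) : ℝ) ^ 2 * α ^ 2 * (η - τ * lam))
      (by positivity)
      (by rw [hC]; exact mul_neg_of_pos_of_neg (by positivity) (sub_neg.mpr hlam))
    refine ⟨β, hβ0, ?_⟩
    rw [← hβ, fjl]
    ring
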